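/- arXiv:2407.21116 — 2 statements merged into one kernel-verified Lean document; each statement's English description precedes it below -/
import Mathlib

section
/- Let n ≥ 3 and let π be a permutation of {1,…,n}. If some reduced word for π contains three consecutive entries of the form (i, i+1, i) or of the form (i+1, i, i+1) for some i with 1 ≤ i ≤ n−2, then π is not 321-avoiding, i.e. there exist indices a < b < c with π(a) > π(b) > π(c). -/
/-- The simple transposition of the symmetric group on `Fin n` exchanging the
(0-based) positions `i` and `i+1`; it is the identity if `i+1 ≥ n`. -/
def simpleTransposition (n : ℕ) (i : ℕ) : Equiv.Perm (Fin n) :=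
  if h : i + 1 < n then Equiv.swap ⟨i, Nat.lt_of_succ_lt h⟩ ⟨i + 1, h⟩ else 1

/-- The number of inversions of a permutation of `Fin n`: pairs `i < j` with `π i > π j`.
This equals the Coxeter length of `π`. -/
def invCount {n : ℕ} (π : Equiv.Perm (Fin n)) : ℕ :=
  (Finset.univ.filter (fun p : Fin n × Fin n => p.1 < p.2 ∧ π p.2 < π p.1)).card

/-- `w` is a reduced word for `π`: a list of (0-based) indices of simple transpositions
whose product is `π` and whose length is the Coxeter length (number of inversions) of `π`. -/
def IsReducedWord (n : ℕ) (π : Equiv.Perm (Fin n)) (w : List ℕ) : Prop :=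
  (∀ i ∈ w, i + 1 < n) ∧ (w.map (simpleTransposition n)).prod = π ∧ w.length = invCount π

theorem st_fst {n i : ℕ} (h : i + 1 < n) :
    simpleTransposition n i ⟨i, by omega⟩ = ⟨i + 1, h⟩ := by
  simp [simpleTransposition, h]

theorem st_snd {n i : ℕ} (h : i + 1 < n) :
    simpleTransposition n i ⟨i + 1, h⟩ = ⟨i, by omega⟩ := by
  simp [simpleTransposition, h]

theorem st_other {n i : ℕ} (x : Fin n) (h1 : x.1 ≠ i) (h2 : x.1 ≠ i + 1) :
    simpleTransposition n i x = x := by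
  unfold simpleTransposition
  split_ifs with h
  · apply Equiv.swap_apply_of_ne_of_ne <;> (intro e; simp [Fin.ext_iff] at e; omega)
  · rfl

theorem st_st {n i : ℕ} (x : Fin n) :
    simpleTransposition n i (simpleTransposition n i x) = x := by
  unfold simpleTransposition
  split_ifs with h <;> simp

theorem st_val {n i : ℕ} (h : i + 1 < n) (x : Fin n) :
    (simpleTransposition n i x).1 =
      if x.1 = i then i + 1 else if x.1 = i + 1 then i else x.1 := by
  obtain ⟨x, hx⟩ := x
  split_ifs with h1 h2
  · simp only at h1; subst h1; rw [st_fst h]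
  · simp only at h2; subst h2; rw [st_snd h]
  · rw [st_other _ h1 h2]

theorem st_lt {n i : ℕ} (h : i + 1 < n) (x y : Fin n) (hxy : x < y)
    (hne : ¬ (x.1 = i ∧ y.1 = i + 1)) :
    simpleTransposition n i x < simpleTransposition n i y := by
  rw [Fin.lt_def] at *
  rw [st_val h, st_val h]
  split_ifs <;> omega

def invSet {n : ℕ} (π : Equiv.Perm (Fin n)) : Finset (Fin n × Fin n) :=
  Finset.univ.filter (fun p : Fin n × Fin n => p.1 < p.2 ∧ π p.2 < π p.1)

theorem mem_invSet {n : ℕ} (π : Equiv.Perm (Fin n)) (x y : Fin n) :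
    (x, y) ∈ invSet π ↔ x < y ∧ π y < π x := by
  simp [invSet]

theorem inv_aux {n i : ℕ} (h : i + 1 < n) (σ : Equiv.Perm (Fin n)) :
    ((invSet (σ * simpleTransposition n i)).erase (⟨i, by omega⟩, ⟨i + 1, h⟩)).card
      ≤ invCount σ := by
  unfold invCount
  apply Finset.card_le_card_of_injOn
    (fun p => (simpleTransposition n i p.1, simpleTransposition n i p.2))
  · rintro ⟨x, y⟩ hp
    rw [Finset.mem_coe, Finset.mem_erase, mem_invSet] at hp
    obtain ⟨hne, hlt, hσ⟩ := hp
    refine Finset.mem_coe.2 ((mem_invSet σ _ _).2 ⟨st_lt h x y hlt ?_, hσ⟩)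
    rintro ⟨h1, h2⟩
    exact hne (Prod.ext (Fin.ext h1) (Fin.ext h2))
  · rintro ⟨x, y⟩ _ ⟨x', y'⟩ _ e
    simpa using e

theorem inv_le {n i : ℕ} (h : i + 1 < n) (σ : Equiv.Perm (Fin n)) :
    invCount (σ * simpleTransposition n i) ≤ invCount σ + 1 := by
  have h1 := inv_aux h σ
  have h2 := Finset.pred_card_le_card_erase (s := invSet (σ * simpleTransposition n i))
    (a := (⟨i, by omega⟩, ⟨i + 1, h⟩))
  change (invSet (σ * simpleTransposition n i)).card ≤ _
  omega

theorem asc {n i : ℕ} (h : i + 1 < n) (σ : Equiv.Perm (Fin n))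
    (hl : invCount σ + 1 ≤ invCount (σ * simpleTransposition n i)) :
    σ ⟨i, by omega⟩ < σ ⟨i + 1, h⟩ := by
  by_contra hc
  have h1 := inv_aux h σ
  rw [Finset.erase_eq_of_notMem] at h1
  · change _ ≤ (invSet (σ * simpleTransposition n i)).card at hl
    omega
  · intro hm
    simp only [mem_invSet, Equiv.Perm.coe_mul, Function.comp_apply,
      st_fst h, st_snd h] at hm
    exact hc hm.2

def Has {n : ℕ} (π : Equiv.Perm (Fin n)) : Prop :=
  ∃ a b c : Fin n, a < b ∧ b < c ∧ π b < π a ∧ π c < π b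

theorem has_step {n i : ℕ} (h : i + 1 < n) (σ : Equiv.Perm (Fin n)) (hs : Has σ)
    (ha : σ ⟨i, by omega⟩ < σ ⟨i + 1, h⟩) : Has (σ * simpleTransposition n i) := by
  have key : ∀ x y : Fin n, x < y → σ y < σ x →
      simpleTransposition n i x < simpleTransposition n i y := by
    intro x y hxy hσ
    apply st_lt h x y hxy
    rintro ⟨h1, h2⟩
    have e1 : x = ⟨i, Nat.lt_of_succ_lt h⟩ := Fin.ext h1
    have e2 : y = ⟨i + 1, h⟩ := Fin.ext h2
    rw [e1, e2] at hσ
    exact lt_asymm ha hσ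
  obtain ⟨a, b, c, h1, h2, h3, h4⟩ := hs
  refine ⟨_, _, _, key a b h1 h3, key b c h2 h4, ?_, ?_⟩ <;>
    simpa [Equiv.Perm.coe_mul, st_st]

theorem inv_list {n : ℕ} (l : List ℕ) (hl : ∀ i ∈ l, i + 1 < n) (σ : Equiv.Perm (Fin n)) :
    invCount (σ * (l.map (simpleTransposition n)).prod) ≤ invCount σ + l.length := by
  induction l generalizing σ with
  | nil => simp
  | cons x l ih =>
    have h1 := ih (fun i hi => hl i (by simp [hi])) (σ * simpleTransposition n x)
    have h2 := inv_le (hl x (by simp)) σ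
    simp only [List.map_cons, List.prod_cons, List.length_cons, ← mul_assoc]
    omega

theorem has_list {n : ℕ} (l : List ℕ) (hl : ∀ i ∈ l, i + 1 < n) (σ : Equiv.Perm (Fin n))
    (hs : Has σ)
    (hc : invCount σ + l.length ≤ invCount (σ * (l.map (simpleTransposition n)).prod)) :
    Has (σ * (l.map (simpleTransposition n)).prod) := by
  induction l generalizing σ with
  | nil => simpa using hs
  | cons x l ih =>
    have hl' : ∀ i ∈ l, i + 1 < n := fun i hi => hl i (by simp [hi])
    have hx := hl x (by simp)
    have h1 := inv_list l hl' (σ * simpleTransposition n x)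
    have h2 := inv_le hx σ
    simp only [List.map_cons, List.prod_cons, List.length_cons, ← mul_assoc] at hc ⊢
    exact ih hl' _ (has_step hx σ hs (asc hx σ (by omega))) (by omega)

theorem main_aux {n : ℕ} (l₁ l₂ : List ℕ) (x y : ℕ) (h₁ : ∀ i ∈ l₁, i + 1 < n)
    (h₂ : ∀ i ∈ l₂, i + 1 < n) (hx : x + 1 < n) (hy : y + 1 < n)
    (hxy : y = x + 1 ∨ x = y + 1)
    (hc : l₁.length + l₂.length + 3 ≤
      invCount ((l₁ ++ x :: y :: x :: l₂).map (simpleTransposition n)).prod) :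
    Has ((l₁ ++ x :: y :: x :: l₂).map (simpleTransposition n)).prod := by
  have h0 := inv_list l₁ h₁ 1
  have hone : invCount (1 : Equiv.Perm (Fin n)) = 0 := by
    simp only [invCount, Finset.card_eq_zero, Finset.filter_eq_empty_iff]
    rintro p - ⟨h, h'⟩
    exact lt_asymm h h'
  rw [one_mul, hone] at h0
  simp only [List.map_append, List.prod_append, List.map_cons, List.prod_cons,
    ← mul_assoc] at hc ⊢
  generalize (l₁.map (simpleTransposition n)).prod = u at *
  have e1 := inv_le hx u
  have e2 := inv_le hy (u * simpleTransposition n x)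
  have e3 := inv_le hx (u * simpleTransposition n x * simpleTransposition n y)
  have e4 := inv_list l₂ h₂
    (u * simpleTransposition n x * simpleTransposition n y * simpleTransposition n x)
  have a1 := asc hx u (by omega)
  have a2 := asc hy (u * simpleTransposition n x) (by omega)
  have a3 := asc hx (u * simpleTransposition n x * simpleTransposition n y) (by omega)
  apply has_list l₂ h₂ _ _ (by omega)
  have o1 : ∀ i (h : i + 1 + 1 < n), simpleTransposition n i ⟨i + 1 + 1, h⟩ = ⟨i + 1 + 1, h⟩ :=
    fun i h => st_other _ (by simp; omega) (by simp)
  have o2 : ∀ i (h : i + 1 + 1 < n), simpleTransposition n (i + 1) ⟨i, by omega⟩ = ⟨i, by omega⟩ :=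
    fun i h => st_other _ (by simp) (by simp; omega)
  rcases hxy with rfl | rfl
  · refine ⟨⟨x, by omega⟩, ⟨x + 1, hx⟩, ⟨x + 1 + 1, hy⟩, by simp, by simp, ?_, ?_⟩ <;>
    simp only [Equiv.Perm.coe_mul, Function.comp_apply, st_fst hx, st_snd hx, st_fst hy, st_snd hy,
      o1 _ hy, o2 _ hy] at * <;> assumption
  · refine ⟨⟨y, by omega⟩, ⟨y + 1, hy⟩, ⟨y + 1 + 1, hx⟩, by simp, by simp, ?_, ?_⟩ <;>
    simp only [Equiv.Perm.coe_mul, Function.comp_apply, st_fst hx, st_snd hx, st_fst hy, st_snd hy,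
      o1 _ hx, o2 _ hx] at * <;> assumption

/-- For `n ≥ 3`, if some reduced word for a permutation `π` of `{1,…,n}`
contains three consecutive entries of the form `(i, i+1, i)` or `(i+1, i, i+1)`
(with both indices valid, i.e. `i + 2 < n` in 0-based indexing), then `π` is not
321-avoiding: there exist indices `a < b < c` with `π a > π b > π c`. -/
theorem not_avoiding321_of_braid_in_reduced_word (n : ℕ) (hn : 3 ≤ n)
    (π : Equiv.Perm (Fin n))
    (h : ∃ w : List ℕ, IsReducedWord n π w ∧
      ∃ l₁ l₂ : List ℕ, ∃ i : ℕ, i + 2 < n ∧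
        (w = l₁ ++ i :: (i + 1) :: i :: l₂ ∨ w = l₁ ++ (i + 1) :: i :: (i + 1) :: l₂)) :
    ∃ a b c : Fin n, a < b ∧ b < c ∧ π b < π a ∧ π c < π b := by
  obtain ⟨w, ⟨hw, hp, hlen⟩, l₁, l₂, i, hi, rfl | rfl⟩ := h
  · subst hp
    exact main_aux l₁ l₂ i (i + 1) (fun j hj => hw j (by simp [hj]))
      (fun j hj => hw j (by simp [hj])) (by omega) (by omega) (Or.inl rfl)
      (by rw [← hlen]; simp; omega)
  · subst hp
    exact main_aux l₁ l₂ (i + 1) i (fun j hj => hw j (by simp [hj]))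
      (fun j hj => hw j (by simp [hj])) (by omega) (by omega) (Or.inr rfl)
      (by rw [← hlen]; simp; omega)
end

section
/- Let D be a reduced rectangular pipe dream of shape a×b that is rigid. Then D reduces to NW/SE partitions. -/
/-- A rectangular pipe dream of shape `a × b`: a set of crosses `D` inside the grid
`{1,…,a} × {1,…,b}` (first coordinate = row, from top to bottom; second = column,
from left to right).  Positions of the grid not in `D` are elbows. -/
def IsPipeDream (a b : ℕ) (D : Finset (ℕ × ℕ)) : Prop :=
  D ⊆ Finset.Icc 1 a ×ˢ Finset.Icc 1 b

/-- The reading word of a rectangular pipe dream of shape `a × b`: read the rows from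
bottom (`i = a`) to top (`i = 1`), each row from left (`j = 1`) to right (`j = b`);
a cross at `(i,j)` contributes the simple transposition `s_{i+j-1}` of `S_{a+b}`
(recorded here by its 0-based index `i + j - 2 = (i-1) + (j-1)`). -/
def readingWord (a b : ℕ) (D : Finset (ℕ × ℕ)) : List ℕ :=
  ((List.range a).reverse.flatMap fun r =>
    (List.range b).filterMap fun c =>
      if (r + 1, c + 1) ∈ D then some (r + c) else none)

/-- The permutation of a rectangular pipe dream: the product of its reading word. -/
def pdPerm (a b : ℕ) (D : Finset (ℕ × ℕ)) : Equiv.Perm (Fin (a + b)) :=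
  ((readingWord a b D).map (simpleTransposition (a + b))).prod

/-- A pipe dream is reduced if the Coxeter length of its permutation equals its number
of crosses. -/
def IsReducedPD (a b : ℕ) (D : Finset (ℕ × ℕ)) : Prop :=
  invCount (pdPerm a b D) = D.card

/-- A reduced rectangular pipe dream is rigid if it is the unique reduced rectangular
pipe dream of its shape with its permutation. -/
def IsRigid (a b : ℕ) (D : Finset (ℕ × ℕ)) : Prop :=
  ∀ D' : Finset (ℕ × ℕ), IsPipeDream a b D' → IsReducedPD a b D' →
    pdPerm a b D' = pdPerm a b D → D' = D

/-- A rectangular pipe dream of shape `a × b` reduces to NW/SE partitions if every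
cross lies in an entire row of crosses, an entire column of crosses, a partition of
crosses in the northwest corner, or a partition of crosses in the southeast corner. -/
def ReducesToNWSEPartitions (a b : ℕ) (D : Finset (ℕ × ℕ)) : Prop :=
  ∀ i j : ℕ, (i, j) ∈ D →
    (∀ jQ : ℕ, 1 ≤ jQ → jQ ≤ b → (i, jQ) ∈ D) ∨
    (∀ iQ : ℕ, 1 ≤ iQ → iQ ≤ a → (iQ, j) ∈ D) ∨
    (∀ iQ jQ : ℕ, 1 ≤ iQ → iQ ≤ i → 1 ≤ jQ → jQ ≤ j → (iQ, jQ) ∈ D) ∨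
    (∀ iQ jQ : ℕ, i ≤ iQ → iQ ≤ a → j ≤ jQ → jQ ≤ b → (iQ, jQ) ∈ D)

/-! helper material -/

def seg {G : Type*} [Monoid G] (f : ℕ → G) (lo : ℕ) : ℕ → G
  | 0 => 1
  | n + 1 => seg f lo n * f (lo + n)

def dseg {G : Type*} [Monoid G] (f : ℕ → G) (lo : ℕ) : ℕ → G
  | 0 => 1
  | n + 1 => f (lo + n) * dseg f lo n

theorem seg_add {G : Type*} [Monoid G] (f : ℕ → G) (lo m n : ℕ) :
    seg f lo (m + n) = seg f lo m * seg f (lo + m) n := by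
  induction n with
  | zero => simp [seg]
  | succ n ih => rw [← add_assoc, seg, seg, ih, mul_assoc, add_assoc]

theorem dseg_add {G : Type*} [Monoid G] (f : ℕ → G) (lo m n : ℕ) :
    dseg f lo (m + n) = dseg f (lo + m) n * dseg f lo m := by
  induction n with
  | zero => simp [dseg]
  | succ n ih => rw [← add_assoc, dseg, dseg, ih, mul_assoc, add_assoc]

theorem seg_congr {G : Type*} [Monoid G] (f g : ℕ → G) (lo n : ℕ)
    (h : ∀ c, lo ≤ c → c < lo + n → f c = g c) : seg f lo n = seg g lo n := by
  induction n with
  | zero => rfl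
  | succ n ih =>
    rw [seg, seg, ih (fun c h1 h2 => h c h1 (by omega)), h (lo + n) (by omega) (by omega)]

theorem dseg_congr {G : Type*} [Monoid G] (f g : ℕ → G) (lo n : ℕ)
    (h : ∀ c, lo ≤ c → c < lo + n → f c = g c) : dseg f lo n = dseg g lo n := by
  induction n with
  | zero => rfl
  | succ n ih =>
    rw [dseg, dseg, ih (fun c h1 h2 => h c h1 (by omega)), h (lo + n) (by omega) (by omega)]

theorem seg_split {G : Type*} [Monoid G] (f : ℕ → G) (c b : ℕ) (h : c < b) :
    seg f 0 b = seg f 0 c * f c * seg f (c + 1) (b - (c + 1)) := by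
  have : b = (c + 1) + (b - (c + 1)) := by omega
  conv_lhs => rw [this, seg_add]
  simp [seg]

theorem dseg_split {G : Type*} [Monoid G] (f : ℕ → G) (c b : ℕ) (h : c < b) :
    dseg f 0 b = dseg f (c + 1) (b - (c + 1)) * f c * dseg f 0 c := by
  have : b = (c + 1) + (b - (c + 1)) := by omega
  conv_lhs => rw [this, dseg_add]
  simp [dseg, mul_assoc]

theorem seg_fix (f : ℕ → Equiv.Perm ℕ) (lo n x : ℕ)
    (h : ∀ c, lo ≤ c → c < lo + n → f c x = x) : seg f lo n x = x := by
  induction n with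
  | zero => rfl
  | succ n ih =>
    rw [seg, Equiv.Perm.mul_apply, h (lo + n) (by omega) (by omega),
      ih (fun c h1 h2 => h c h1 (by omega))]

theorem seg_shift (f : ℕ → Equiv.Perm ℕ) (r lo n : ℕ)
    (h : ∀ c, lo ≤ c → c < lo + n → f c = Equiv.swap (r + c) (r + c + 1)) :
    seg f lo n (r + lo + n) = r + lo := by
  induction n with
  | zero => rfl
  | succ n ih =>
    rw [seg, Equiv.Perm.mul_apply, h (lo + n) (by omega) (by omega)]
    have : r + lo + (n + 1) = r + (lo + n) + 1 := by omega
    rw [this, Equiv.swap_apply_right, ← add_assoc]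
    exact ih (fun c h1 h2 => h c h1 (by omega))

noncomputable def cellP (D : Finset (ℕ × ℕ)) (r c : ℕ) : Equiv.Perm ℕ :=
  if (r + 1, c + 1) ∈ D then Equiv.swap (r + c) (r + c + 1) else 1

theorem cellP_fix (D : Finset (ℕ × ℕ)) (r c x : ℕ) (h1 : x ≠ r + c) (h2 : x ≠ r + c + 1) :
    cellP D r c x = x := by
  unfold cellP
  split_ifs
  · exact Equiv.swap_apply_of_ne_of_ne h1 h2
  · rfl

noncomputable def bigP (a b : ℕ) (D : Finset (ℕ × ℕ)) : Equiv.Perm ℕ :=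
  dseg (fun r => seg (cellP D r) 0 b) 0 a

noncomputable def phi (n : ℕ) : Equiv.Perm (Fin n) →* Equiv.Perm ℕ :=
  Equiv.Perm.viaEmbeddingHom (Fin.valEmbedding)

theorem phi_inj (n : ℕ) : Function.Injective (phi n) :=
  Equiv.Perm.viaEmbeddingHom_injective _

theorem phi_simple (n i : ℕ) (h : i + 1 < n) :
    phi n (simpleTransposition n i) = Equiv.swap i (i + 1) := by
  ext x
  unfold phi simpleTransposition
  rw [dif_pos h, Equiv.Perm.viaEmbeddingHom_apply]
  by_cases hx : x < n
  · have := Equiv.Perm.viaEmbedding_apply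
      (Equiv.swap (⟨i, Nat.lt_of_succ_lt h⟩ : Fin n) ⟨i + 1, h⟩) Fin.valEmbedding ⟨x, hx⟩
    simp only [Fin.valEmbedding_apply] at this
    rw [this]
    simp only [Equiv.swap_apply_def, Fin.ext_iff]
    split_ifs <;> rfl
  · rw [Equiv.Perm.viaEmbedding_apply_of_notMem]
    · rw [Equiv.swap_apply_of_ne_of_ne] <;> omega
    · rintro ⟨y, rfl⟩
      exact hx y.2

theorem phi_row (n r b : ℕ) (D : Finset (ℕ × ℕ)) (h : r + b < n) :
    phi n ((((List.range b).filterMap fun c =>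
      if (r + 1, c + 1) ∈ D then some (r + c) else none).map (simpleTransposition n)).prod)
      = seg (cellP D r) 0 b := by
  induction b with
  | zero => simp [seg]
  | succ b ih =>
    rw [List.range_succ, List.filterMap_append, List.map_append, List.prod_append, map_mul,
      ih (by omega), seg]
    congr 1
    unfold cellP
    by_cases hc : (r + 1, b + 1) ∈ D
    · simp [hc, phi_simple n (r + b) (by omega)]
    · simp [hc]

theorem phi_pd_aux (n a b : ℕ) (D : Finset (ℕ × ℕ)) (h : a + b ≤ n) :
    phi n (((readingWord a b D).map (simpleTransposition n)).prod) = bigP a b D := by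
  unfold bigP
  induction a with
  | zero => simp [readingWord, dseg]
  | succ a ih =>
    rw [dseg, ← ih (by omega)]
    unfold readingWord
    rw [List.range_succ, List.reverse_append, List.flatMap_append, List.map_append,
      List.prod_append, map_mul]
    congr 1
    simp only [List.reverse_singleton, List.flatMap_singleton, zero_add]
    exact phi_row n a b D (by omega)

theorem phi_pd (a b : ℕ) (D : Finset (ℕ × ℕ)) :
    phi (a + b) (pdPerm a b D) = bigP a b D := phi_pd_aux _ _ _ _ le_rfl

theorem pd_eq_of_bigP (a b : ℕ) (D D' : Finset (ℕ × ℕ)) (h : bigP a b D = bigP a b D') :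
    pdPerm a b D = pdPerm a b D' := by
  apply phi_inj
  rw [phi_pd, phi_pd, h]

noncomputable def midP (b r0 r1 c0 c1 : ℕ) (D : Finset (ℕ × ℕ)) : Equiv.Perm ℕ :=
  seg (cellP D r1) (c0 + 1) (b - (c0 + 1)) *
    dseg (fun r => seg (cellP D r) 0 b) (r0 + 1) (r1 - (r0 + 1)) * seg (cellP D r0) 0 c1

theorem bigP_split (a b r0 r1 c0 c1 : ℕ) (D : Finset (ℕ × ℕ)) (hr : r0 < r1) (hra : r1 < a)
    (hc0 : c0 < b) (hcb : c1 < b) :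
    bigP a b D = (dseg (fun r => seg (cellP D r) 0 b) (r1 + 1) (a - (r1 + 1)) *
      seg (cellP D r1) 0 c0) * cellP D r1 c0 * midP b r0 r1 c0 c1 D * cellP D r0 c1 *
      (seg (cellP D r0) (c1 + 1) (b - (c1 + 1)) *
        dseg (fun r => seg (cellP D r) 0 b) 0 r0) := by
  unfold bigP midP
  rw [dseg_split _ r1 a hra]
  have e : r1 = (r0 + 1) + (r1 - (r0 + 1)) := by omega
  have : dseg (fun r => seg (cellP D r) 0 b) 0 r1 =
    dseg (fun r => seg (cellP D r) 0 b) (r0 + 1) (r1 - (r0 + 1)) *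
      (seg (cellP D r0) 0 b * dseg (fun r => seg (cellP D r) 0 b) 0 r0) := by
    conv_lhs => rw [e, dseg_add]
    simp [dseg]
  rw [this]
  rw [seg_split (cellP D r1) c0 b hc0, seg_split (cellP D r0) c1 b hcb]
  simp only [mul_assoc]

theorem mid_rows (b r0 c0 c1 : ℕ) (D : Finset (ℕ × ℕ)) (hc : c0 < c1) (hcb : c1 < b) (n : ℕ)
    (hm : ∀ r, r0 < r → r < r0 + 1 + n → (r + 1, c0 + 1) ∈ D ∧ (r + 1, c1 + 1) ∈ D) :
    dseg (fun r => seg (cellP D r) 0 b) (r0 + 1) n (r0 + 1 + c0) = r0 + 1 + n + c0 ∧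
    dseg (fun r => seg (cellP D r) 0 b) (r0 + 1) n (r0 + 1 + c1) = r0 + 1 + n + c1 := by
  induction n with
  | zero => simp [dseg]
  | succ n ih =>
    obtain ⟨h1, h2⟩ := ih (fun r hr hr' => hm r hr (by omega))
    obtain ⟨m1, m2⟩ := hm (r0 + 1 + n) (by omega) (by omega)
    simp only [dseg, Equiv.Perm.mul_apply, h1, h2]
    set r := r0 + 1 + n
    constructor
    · rw [seg_split _ c0 b (by omega), Equiv.Perm.mul_apply, Equiv.Perm.mul_apply,
        seg_fix _ (c0 + 1) _ _ (fun c _ _ => cellP_fix _ _ _ _ (by omega) (by omega))]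
      rw [cellP, if_pos m1, Equiv.swap_apply_left,
        seg_fix _ _ _ _ (fun c _ _ => cellP_fix _ _ _ _ (by omega) (by omega))]
      omega
    · rw [seg_split _ c1 b (by omega), Equiv.Perm.mul_apply, Equiv.Perm.mul_apply,
        seg_fix _ (c1 + 1) _ _ (fun c _ _ => cellP_fix _ _ _ _ (by omega) (by omega))]
      rw [cellP, if_pos m2, Equiv.swap_apply_left,
        seg_fix _ _ _ _ (fun c _ _ => cellP_fix _ _ _ _ (by omega) (by omega))]
      omega

theorem cellP_one (D : Finset (ℕ × ℕ)) (r c : ℕ) (h : (r + 1, c + 1) ∉ D) : cellP D r c = 1 := by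
  rw [cellP, if_neg h]

theorem mid_comm (b r0 r1 c0 c1 : ℕ) (D : Finset (ℕ × ℕ)) (hr : r0 < r1)
    (hc : c0 < c1) (hcb : c1 < b)
    (hNW : (r0 + 1, c0 + 1) ∉ D) (hSE : (r1 + 1, c1 + 1) ∉ D)
    (hrow : ∀ c, c0 < c → c < c1 → (r0 + 1, c + 1) ∈ D ∧ (r1 + 1, c + 1) ∈ D)
    (hcol : ∀ r, r0 < r → r < r1 → (r + 1, c0 + 1) ∈ D ∧ (r + 1, c1 + 1) ∈ D) :
    midP b r0 r1 c0 c1 D * Equiv.swap (r0 + c1) (r0 + c1 + 1) =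
      Equiv.swap (r1 + c0) (r1 + c0 + 1) * midP b r0 r1 c0 c1 D := by
  obtain ⟨m1, m2⟩ := mid_rows b r0 c0 c1 D hc hcb (r1 - (r0 + 1))
    (fun r h1 h2 => hcol r h1 (by omega))
  have e : r0 + 1 + (r1 - (r0 + 1)) = r1 := by omega
  rw [e] at m1 m2
  have a1 : seg (cellP D r0) 0 c1 (r0 + c1) = r0 + 1 + c0 := by
    rw [seg_split _ c0 c1 hc, Equiv.Perm.mul_apply, Equiv.Perm.mul_apply]
    have := seg_shift (cellP D r0) r0 (c0 + 1) (c1 - (c0 + 1))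
      (fun c h1 h2 => by rw [cellP, if_pos (hrow c (by omega) (by omega)).1])
    rw [show r0 + (c0 + 1) + (c1 - (c0 + 1)) = r0 + c1 by omega] at this
    rw [this, cellP_one _ _ _ hNW, Equiv.Perm.one_apply,
        seg_fix _ _ _ _ (fun c _ _ => cellP_fix _ _ _ _ (by omega) (by omega))]
    omega
  have a2 : seg (cellP D r0) 0 c1 (r0 + c1 + 1) = r0 + 1 + c1 := by
    rw [seg_fix _ _ _ _ (fun c _ _ => cellP_fix _ _ _ _ (by omega) (by omega))]
    omega
  have b1 : seg (cellP D r1) (c0 + 1) (b - (c0 + 1)) (r1 + c0) = r1 + c0 :=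
    seg_fix _ _ _ _ (fun c _ _ => cellP_fix _ _ _ _ (by omega) (by omega))
  have b2 : seg (cellP D r1) (c0 + 1) (b - (c0 + 1)) (r1 + c1) = r1 + c0 + 1 := by
    rw [show b - (c0 + 1) = (c1 - (c0 + 1)) + (1 + (b - (c1 + 1))) by omega, seg_add, seg_add,
      Equiv.Perm.mul_apply, Equiv.Perm.mul_apply,
      show c0 + 1 + (c1 - (c0 + 1)) = c1 by omega,
      seg_fix _ (c1 + 1) _ _ (fun c _ _ => cellP_fix _ _ _ _ (by omega) (by omega))]
    have := seg_shift (cellP D r1) r1 (c0 + 1) (c1 - (c0 + 1))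
      (fun c h1 h2 => by rw [cellP, if_pos (hrow c (by omega) (by omega)).2])
    rw [show r1 + (c0 + 1) + (c1 - (c0 + 1)) = r1 + c1 by omega] at this
    simp only [seg, add_zero, one_mul]
    rw [cellP_one _ _ _ hSE, Equiv.Perm.one_apply, this]
    omega
  have w1 : midP b r0 r1 c0 c1 D (r0 + c1) = r1 + c0 := by
    rw [midP, Equiv.Perm.mul_apply, Equiv.Perm.mul_apply, a1, m1, b1]
  have w2 : midP b r0 r1 c0 c1 D (r0 + c1 + 1) = r1 + c0 + 1 := by
    rw [midP, Equiv.Perm.mul_apply, Equiv.Perm.mul_apply, a2, m2, b2]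
  rw [Equiv.mul_swap_eq_swap_mul, w1, w2]

/-- the exchange lemma -/
theorem exchange (a b r0 r1 c0 c1 : ℕ) (D D' : Finset (ℕ × ℕ)) (hr : r0 < r1) (hra : r1 < a)
    (hc : c0 < c1) (hcb : c1 < b)
    (hNW : (r0 + 1, c0 + 1) ∉ D) (hSE : (r1 + 1, c1 + 1) ∉ D)
    (hrow : ∀ c, c0 < c → c < c1 → (r0 + 1, c + 1) ∈ D ∧ (r1 + 1, c + 1) ∈ D)
    (hcol : ∀ r, r0 < r → r < r1 → (r + 1, c0 + 1) ∈ D ∧ (r + 1, c1 + 1) ∈ D)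
    (hagree : ∀ r c, (r, c) ≠ (r1, c0) → (r, c) ≠ (r0, c1) →
      ((r + 1, c + 1) ∈ D' ↔ (r + 1, c + 1) ∈ D))
    (hsw : (((r1 + 1, c0 + 1) ∈ D ↔ (r0 + 1, c1 + 1) ∈ D) ∧
        (r1 + 1, c0 + 1) ∉ D' ∧ (r0 + 1, c1 + 1) ∉ D') ∨
      (((r1 + 1, c0 + 1) ∈ D' ↔ (r0 + 1, c1 + 1) ∈ D) ∧
        ((r0 + 1, c1 + 1) ∈ D' ↔ (r1 + 1, c0 + 1) ∈ D))) :
    pdPerm a b D' = pdPerm a b D := by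
  apply pd_eq_of_bigP
  have hcell : ∀ r c, (r, c) ≠ (r1, c0) → (r, c) ≠ (r0, c1) → cellP D' r c = cellP D r c := by
    intro r c h1 h2
    unfold cellP
    simp only [hagree r c h1 h2]
  have hfull : ∀ r, r ≠ r0 → r ≠ r1 → seg (cellP D' r) 0 b = seg (cellP D r) 0 b := by
    intro r h1 h2
    apply seg_congr
    intro c _ _
    apply hcell <;> grind
  rw [bigP_split a b r0 r1 c0 c1 D' hr hra (by omega) hcb,
    bigP_split a b r0 r1 c0 c1 D hr hra (by omega) hcb]
  have hmid : midP b r0 r1 c0 c1 D' = midP b r0 r1 c0 c1 D := by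
    unfold midP
    rw [seg_congr (cellP D' r1) (cellP D r1) _ _ (fun c _ _ => hcell _ _ (by grind) (by grind)),
      seg_congr (cellP D' r0) (cellP D r0) _ _ (fun c _ _ => hcell _ _ (by grind) (by grind)),
      dseg_congr _ _ _ _ (fun c _ _ => hfull c (by omega) (by omega))]
  rw [hmid,
    seg_congr (cellP D' r1) (cellP D r1) 0 c0 (fun c _ _ => hcell _ _ (by grind) (by grind)),
    seg_congr (cellP D' r0) (cellP D r0) (c1 + 1) _
      (fun c _ _ => hcell _ _ (by grind) (by grind)),
    dseg_congr (fun r => seg (cellP D' r) 0 b) (fun r => seg (cellP D r) 0 b) (r1 + 1) _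
      (fun c _ _ => hfull c (by omega) (by omega)),
    dseg_congr (fun r => seg (cellP D' r) 0 b) (fun r => seg (cellP D r) 0 b) 0 r0
      (fun c _ _ => hfull c (by omega) (by omega))]
  have key : cellP D' r1 c0 * midP b r0 r1 c0 c1 D * cellP D' r0 c1 =
      cellP D r1 c0 * midP b r0 r1 c0 c1 D * cellP D r0 c1 := by
    have comm := mid_comm b r0 r1 c0 c1 D hr hc hcb hNW hSE hrow hcol
    unfold cellP
    rcases hsw with ⟨h1, h2, h3⟩ | ⟨h1, h2⟩
    · rw [if_neg h2, if_neg h3]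
      simp only [h1]
      split_ifs
      · rw [← comm]; simp [mul_assoc]
      · rfl
    · simp only [h1, h2]
      split_ifs
      · rfl
      · rw [← comm]; simp
      · rw [one_mul, mul_one, comm]
      · rfl
  simp only [mul_assoc] at key ⊢
  congr 2
  rw [← mul_assoc (midP b r0 r1 c0 c1 D), ← mul_assoc (cellP D' r1 c0), key]
  simp only [mul_assoc]

theorem invCount_mul_simple (n i : ℕ) (π : Equiv.Perm (Fin n)) :
    invCount (π * simpleTransposition n i) ≤ invCount π + 1 := by
  unfold simpleTransposition
  split_ifs with h
  swap
  · simp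
  set x : Fin n := ⟨i, Nat.lt_of_succ_lt h⟩ with hx
  set y : Fin n := ⟨i + 1, h⟩ with hy
  unfold invCount
  set A := Finset.univ.filter (fun p : Fin n × Fin n => p.1 < p.2 ∧
    (π * Equiv.swap x y) p.2 < (π * Equiv.swap x y) p.1) with hA
  set B := Finset.univ.filter (fun p : Fin n × Fin n => p.1 < p.2 ∧ π p.2 < π p.1) with hB
  have h1 : (A.erase (x, y)).card ≤ B.card := by
    apply Finset.card_le_card_of_injOn
      (fun p => (Equiv.swap x y p.1, Equiv.swap x y p.2))
    · rintro ⟨p, q⟩ hp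
      rw [Finset.mem_coe] at hp ⊢
      rw [Finset.mem_erase, hA, Finset.mem_filter] at hp
      rw [hB, Finset.mem_filter]
      refine ⟨Finset.mem_univ _, ?_, hp.2.2.2⟩
      obtain ⟨hne, -, hlt, -⟩ := hp
      rw [ne_eq, Prod.mk.injEq] at hne
      clear hA hB
      clear A B
      simp only [Equiv.swap_apply_def, Fin.ext_iff, hx, hy] at *
      split_ifs <;> simp only [Fin.lt_def] at * <;> omega
    · rintro ⟨p, q⟩ _ ⟨p', q'⟩ _ heq
      simpa using heq
  have h2 := Finset.pred_card_le_card_erase (s := A) (a := (x, y))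
  omega

theorem invCount_word (n : ℕ) (l : List ℕ) :
    invCount ((l.map (simpleTransposition n)).prod) ≤ l.length := by
  induction l using List.reverseRecOn with
  | nil =>
    simp only [List.map_nil, List.prod_nil, List.length_nil, Nat.le_zero, invCount,
      Finset.card_eq_zero, Finset.filter_eq_empty_iff]
    rintro ⟨p, q⟩ - ⟨h1, h2⟩
    exact absurd h1 (not_lt.mpr h2.le)
  | append_singleton l x ih =>
    rw [List.map_append, List.prod_append, List.length_append]
    simp only [List.map_singleton, List.prod_singleton, List.length_singleton]
    have := invCount_mul_simple n x ((l.map (simpleTransposition n)).prod)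
    omega

theorem row_length (r b : ℕ) (D : Finset (ℕ × ℕ)) :
    ((List.range b).filterMap fun c =>
      if (r + 1, c + 1) ∈ D then some (r + c) else none).length ≤
      (D.filter (fun p => p.1 = r + 1 ∧ p.2 ≤ b)).card := by
  induction b with
  | zero => simp
  | succ b ih =>
    rw [List.range_succ, List.filterMap_append, List.length_append]
    by_cases hc : (r + 1, b + 1) ∈ D
    · have : insert (r + 1, b + 1) (D.filter (fun p => p.1 = r + 1 ∧ p.2 ≤ b)) ⊆
        D.filter (fun p => p.1 = r + 1 ∧ p.2 ≤ b + 1) := by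
        intro p
        simp only [Finset.mem_insert, Finset.mem_filter]
        rintro (rfl | ⟨h1, h2, h3⟩)
        · exact ⟨hc, rfl, le_rfl⟩
        · exact ⟨h1, h2, by omega⟩
      have h2 := Finset.card_le_card this
      rw [Finset.card_insert_of_notMem (by simp)] at h2
      simp [hc]
      omega
    · have : D.filter (fun p => p.1 = r + 1 ∧ p.2 ≤ b) ⊆
        D.filter (fun p => p.1 = r + 1 ∧ p.2 ≤ b + 1) := by
        intro p
        simp only [Finset.mem_filter]
        rintro ⟨h1, h2, h3⟩
        exact ⟨h1, h2, by omega⟩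
      have h2 := Finset.card_le_card this
      simp [hc]
      omega

theorem word_length (a b : ℕ) (D : Finset (ℕ × ℕ)) :
    (readingWord a b D).length ≤ (D.filter (fun p => p.1 ≤ a)).card := by
  induction a with
  | zero => simp [readingWord]
  | succ a ih =>
    unfold readingWord at *
    rw [List.range_succ, List.reverse_append, List.flatMap_append, List.length_append]
    simp only [List.reverse_singleton, List.flatMap_singleton]
    have h1 := row_length a b D
    have h2 : Disjoint (D.filter (fun p => p.1 = a + 1 ∧ p.2 ≤ b))
        (D.filter (fun p => p.1 ≤ a)) := by
      rw [Finset.disjoint_left]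
      intro p
      simp only [Finset.mem_filter]
      rintro ⟨_, h, _⟩ ⟨_, h'⟩
      omega
    have h3 : D.filter (fun p => p.1 = a + 1 ∧ p.2 ≤ b) ∪ D.filter (fun p => p.1 ≤ a) ⊆
        D.filter (fun p => p.1 ≤ a + 1) := by
      intro p
      simp only [Finset.mem_union, Finset.mem_filter]
      rintro (⟨h1, h2, h3⟩ | ⟨h1, h2⟩)
      · exact ⟨h1, by omega⟩
      · exact ⟨h1, by omega⟩
    have h4 := Finset.card_le_card h3
    rw [Finset.card_union_of_disjoint h2] at h4
    omega

theorem invCount_le (a b : ℕ) (D : Finset (ℕ × ℕ)) : invCount (pdPerm a b D) ≤ D.card :=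
  (invCount_word _ _).trans ((word_length a b D).trans (Finset.card_filter_le _ _))

theorem no_frame (a b : ℕ) (D : Finset (ℕ × ℕ))
    (hpd : IsPipeDream a b D) (hred : IsReducedPD a b D) (hrig : IsRigid a b D)
    (r0 r1 c0 c1 : ℕ) (hr : r0 < r1) (hra : r1 < a) (hc : c0 < c1) (hcb : c1 < b)
    (hNW : (r0 + 1, c0 + 1) ∉ D) (hSE : (r1 + 1, c1 + 1) ∉ D)
    (hrow : ∀ c, c0 < c → c < c1 → (r0 + 1, c + 1) ∈ D ∧ (r1 + 1, c + 1) ∈ D)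
    (hcol : ∀ r, r0 < r → r < r1 → (r + 1, c0 + 1) ∈ D ∧ (r + 1, c1 + 1) ∈ D) :
    (r1 + 1, c0 + 1) ∉ D ∧ (r0 + 1, c1 + 1) ∉ D := by
  have hne : ((r1 + 1, c0 + 1) : ℕ × ℕ) ≠ (r0 + 1, c1 + 1) := by
    intro h
    simp only [Prod.mk.injEq] at h
    omega
  have move : ∀ p q : ℕ × ℕ, p ∈ D → q ∉ D → q ∈ Finset.Icc 1 a ×ˢ Finset.Icc 1 b →
      pdPerm a b (insert q (D.erase p)) = pdPerm a b D → False := by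
    intro p q hp hq hq' he
    have hD : insert q (D.erase p) = D := by
      apply hrig _ _ _ he
      · exact Finset.insert_subset hq' ((Finset.erase_subset _ _).trans hpd)
      · unfold IsReducedPD
        rw [he, Finset.card_insert_of_notMem (fun h => hq (Finset.mem_of_mem_erase h)),
          Finset.card_erase_add_one hp]
        exact hred
    exact hq (hD ▸ Finset.mem_insert_self _ _)
  by_cases h1 : (r1 + 1, c0 + 1) ∈ D <;> by_cases h2 : (r0 + 1, c1 + 1) ∈ D
  · exfalso
    have he : pdPerm a b ((D.erase (r1 + 1, c0 + 1)).erase (r0 + 1, c1 + 1)) = pdPerm a b D := by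
      apply exchange a b r0 r1 c0 c1 _ _ hr hra hc hcb hNW hSE hrow hcol
      · intro r c h3 h4
        simp only [Finset.mem_erase, ne_eq, Prod.mk.injEq] at *
        grind
      · left
        simp [h1, h2]
    have h3 := invCount_le a b ((D.erase (r1 + 1, c0 + 1)).erase (r0 + 1, c1 + 1))
    rw [he, hred] at h3
    have h4 := Finset.card_erase_lt_of_mem h1
    have h5 := Finset.card_erase_le (s := D.erase (r1 + 1, c0 + 1)) (a := (r0 + 1, c1 + 1))
    omega
  · exfalso
    apply move _ _ h1 h2 (by simp; omega)
    apply exchange a b r0 r1 c0 c1 _ _ hr hra hc hcb hNW hSE hrow hcol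
    · intro r c h3 h4
      simp only [Finset.mem_insert, Finset.mem_erase, ne_eq, Prod.mk.injEq] at *
      grind
    · right
      simp only [Finset.mem_insert, Finset.mem_erase]
      grind
  · exfalso
    apply move _ _ h2 h1 (by simp; omega)
    apply exchange a b r0 r1 c0 c1 _ _ hr hra hc hcb hNW hSE hrow hcol
    · intro r c h3 h4
      simp only [Finset.mem_insert, Finset.mem_erase, ne_eq, Prod.mk.injEq] at *
      grind
    · right
      simp only [Finset.mem_insert, Finset.mem_erase]
      grind
  · exact ⟨h1, h2⟩

theorem no_RU (a b : ℕ) (D : Finset (ℕ × ℕ))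
    (hpd : IsPipeDream a b D) (hred : IsReducedPD a b D) (hrig : IsRigid a b D) (N : ℕ) :
    ∀ r0 r1 c0 c1 : ℕ, r0 < r1 → r1 < a → c0 < c1 → c1 < b → (r1 - r0) + (c1 - c0) ≤ N →
      (r1 + 1, c0 + 1) ∈ D → (r0 + 1, c0 + 1) ∉ D → (r1 + 1, c1 + 1) ∉ D → False := by
  induction N with
  | zero => intros; omega
  | succ N ih =>
    intro r0 r1 c0 c1 hr hra hc hcb hN h1 h2 h3
    have k1 : ∀ r, r0 < r → r < r1 → (r + 1, c0 + 1) ∈ D := by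
      intro r hr hr'
      by_contra h
      exact ih r r1 c0 c1 hr' hra hc hcb (by omega) h1 h h3
    have k2 : ∀ c, c0 < c → c < c1 → (r1 + 1, c + 1) ∈ D := by
      intro c hc hc'
      by_contra h
      exact ih r0 r1 c0 c hr hra hc (by omega) (by omega) h1 h2 h
    have k3 : ∀ r, r0 < r → r < r1 → (r + 1, c1 + 1) ∈ D := by
      intro r hr hr'
      by_contra h
      exact ih r0 r c0 c1 hr (by omega) hc hcb (by omega) (k1 r hr hr') h2 h
    have k4 : ∀ c, c0 < c → c < c1 → (r0 + 1, c + 1) ∈ D := by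
      intro c hc hc'
      by_contra h
      exact ih r0 r1 c c1 hr hra hc' hcb (by omega) (k2 c hc hc') h h3
    exact (no_frame a b D hpd hred hrig r0 r1 c0 c1 hr hra hc hcb h2 h3
      (fun c x y => ⟨k4 c x y, k2 c x y⟩) (fun r x y => ⟨k1 r x y, k3 r x y⟩)).1 h1

theorem no_LD (a b : ℕ) (D : Finset (ℕ × ℕ))
    (hpd : IsPipeDream a b D) (hred : IsReducedPD a b D) (hrig : IsRigid a b D) (N : ℕ) :
    ∀ r0 r1 c0 c1 : ℕ, r0 < r1 → r1 < a → c0 < c1 → c1 < b → (r1 - r0) + (c1 - c0) ≤ N →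
      (r0 + 1, c1 + 1) ∈ D → (r0 + 1, c0 + 1) ∉ D → (r1 + 1, c1 + 1) ∉ D → False := by
  induction N with
  | zero => intros; omega
  | succ N ih =>
    intro r0 r1 c0 c1 hr hra hc hcb hN h1 h2 h3
    have k1 : ∀ r, r0 < r → r < r1 → (r + 1, c1 + 1) ∈ D := by
      intro r hr hr'
      by_contra h
      exact ih r0 r c0 c1 hr (by omega) hc hcb (by omega) h1 h2 h
    have k2 : ∀ c, c0 < c → c < c1 → (r0 + 1, c + 1) ∈ D := by
      intro c hc hc'
      by_contra h
      exact ih r0 r1 c c1 hr hra hc' hcb (by omega) h1 h h3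
    have k3 : ∀ r, r0 < r → r < r1 → (r + 1, c0 + 1) ∈ D := by
      intro r hr hr'
      by_contra h
      exact ih r r1 c0 c1 hr' hra hc hcb (by omega) (k1 r hr hr') h h3
    have k4 : ∀ c, c0 < c → c < c1 → (r1 + 1, c + 1) ∈ D := by
      intro c hc hc'
      by_contra h
      exact ih r0 r1 c0 c hr hra hc (by omega) (by omega) (k2 c hc hc') h2 h
    exact (no_frame a b D hpd hred hrig r0 r1 c0 c1 hr hra hc hcb h2 h3
      (fun c x y => ⟨k2 c x y, k4 c x y⟩) (fun r x y => ⟨k3 r x y, k1 r x y⟩)).2 h1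

/-- Every rigid reduced rectangular pipe dream of shape `a × b` reduces
to NW/SE partitions. -/
theorem rigid_reduces_to_NWSE (a b : ℕ) (D : Finset (ℕ × ℕ))
    (hpd : IsPipeDream a b D) (hred : IsReducedPD a b D) (hrig : IsRigid a b D) :
    ReducesToNWSEPartitions a b D := by
  have RU : ∀ i0 i j j1 : ℕ, 1 ≤ i0 → i0 < i → i ≤ a → 1 ≤ j → j < j1 → j1 ≤ b →
      (i, j) ∈ D → (i0, j) ∉ D → (i, j1) ∈ D := by
    intro i0 i j j1 h1 h2 h3 h4 h5 h6 m1 m2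
    by_contra m3
    obtain ⟨i0, rfl⟩ := Nat.exists_eq_add_of_le' h1
    obtain ⟨i, rfl⟩ := Nat.exists_eq_add_of_le' (h1.trans h2.le)
    obtain ⟨j, rfl⟩ := Nat.exists_eq_add_of_le' h4
    obtain ⟨j1, rfl⟩ := Nat.exists_eq_add_of_le' (h4.trans h5.le)
    exact no_RU a b D hpd hred hrig _ i0 i j j1 (by omega) (by omega) (by omega) (by omega)
      le_rfl m1 m2 m3
  have LD : ∀ i i1 j0 j : ℕ, 1 ≤ i → i < i1 → i1 ≤ a → 1 ≤ j0 → j0 < j → j ≤ b →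
      (i, j) ∈ D → (i, j0) ∉ D → (i1, j) ∈ D := by
    intro i i1 j0 j h1 h2 h3 h4 h5 h6 m1 m2
    by_contra m3
    obtain ⟨i, rfl⟩ := Nat.exists_eq_add_of_le' h1
    obtain ⟨i1, rfl⟩ := Nat.exists_eq_add_of_le' (h1.trans h2.le)
    obtain ⟨j0, rfl⟩ := Nat.exists_eq_add_of_le' h4
    obtain ⟨j, rfl⟩ := Nat.exists_eq_add_of_le' (h4.trans h5.le)
    exact no_LD a b D hpd hred hrig _ i i1 j0 j (by omega) (by omega) (by omega) (by omega)
      le_rfl m1 m2 m3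
  intro i j hij
  have hb := hpd hij
  simp only [Finset.mem_product, Finset.mem_Icc] at hb
  obtain ⟨⟨hi1, hia⟩, hj1, hjb⟩ := hb
  by_cases hrow : ∀ jQ : ℕ, 1 ≤ jQ → jQ ≤ b → (i, jQ) ∈ D
  · exact Or.inl hrow
  by_cases hcol : ∀ iQ : ℕ, 1 ≤ iQ → iQ ≤ a → (iQ, j) ∈ D
  · exact Or.inr (Or.inl hcol)
  refine Or.inr (Or.inr ?_)
  push Not at hrow hcol
  obtain ⟨j', hj'1, hj'b, hj'⟩ := hrow
  obtain ⟨i', hi'1, hi'a, hi'⟩ := hcol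
  rcases lt_trichotomy j' j with hlt | rfl | hlt
  · -- elbow to the left: southeast partition
    right
    have down : ∀ iQ, i ≤ iQ → iQ ≤ a → (iQ, j) ∈ D := by
      intro iQ h1 h2
      rcases h1.eq_or_lt with rfl | h1
      · exact hij
      · exact LD i iQ j' j hi1 h1 h2 hj'1 hlt hjb hij hj'
    have hup : i' < i := by
      by_contra h
      exact hi' (down i' (by omega) hi'a)
    intro iQ jQ h1 h2 h3 h4
    have hr : (i, jQ) ∈ D := by
      rcases h3.eq_or_lt with rfl | h3
      · exact hij
      · exact RU i' i j jQ hi'1 hup hia hj1 h3 h4 hij hi'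
    rcases h1.eq_or_lt with rfl | h1
    · exact hr
    · exact LD i iQ j' jQ hi1 h1 h2 hj'1 (by omega) h4 hr hj'
  · exact absurd hij hj'
  · left
    have up : ∀ iQ, 1 ≤ iQ → iQ ≤ i → (iQ, j) ∈ D := by
      intro iQ h1 h2
      rcases h2.eq_or_lt with rfl | h2
      · exact hij
      · by_contra h
        exact hj' (RU iQ i j j' h1 h2 hia hj1 hlt hj'b hij h)
    have hdown : i < i' := by
      by_contra h
      exact hi' (up i' hi'1 (by omega))
    intro iQ jQ h1 h2 h3 h4
    have hl : (i, jQ) ∈ D := by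
      rcases h4.eq_or_lt with rfl | h4
      · exact hij
      · by_contra h
        exact hi' (LD i i' jQ j hi1 hdown hi'a h3 h4 hjb hij h)
    rcases h2.eq_or_lt with rfl | h2
    · exact hl
    · by_contra h
      exact hj' (RU iQ i jQ j' h1 h2 hia h3 (by omega) hj'b hl h)
end
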